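/- arXiv:0808.1480 — 3 statements merged into one kernel-verified Lean document; each statement's English description precedes it below -/
import Mathlib

section
/- For every integer k ≥ 0, the Bessel moments satisfy the three-term recursion 64(k+3)c_{4,k+4} − 4(k+2)(5k²+20k+23)c_{4,k+2} + (k+1)⁵c_{4,k} = 0. -/
open MeasureTheory

/-- The modified Bessel function `K₀`, via `K₀(x) = ∫₀^∞ exp(−x cosh t) dt`. -/
noncomputable def besselK0 (x : ℝ) : ℝ :=
  ∫ t in Set.Ioi (0 : ℝ), Real.exp (-x * Real.cosh t)

/-- The Bessel moment `c_{m,k} = ∫₀^∞ x^k K₀(x)^m dx`. -/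
noncomputable def besselMoment (m k : ℕ) : ℝ :=
  ∫ x in Set.Ioi (0 : ℝ), x ^ k * besselK0 x ^ m

/-- The integral `∫₀^∞ cosh(t)^n exp(−x cosh t) dt`; its value for `n = 0` is `K₀(x)`. -/
noncomputable def coshExpIntegral (n : ℕ) (x : ℝ) : ℝ :=
  ∫ t in Set.Ioi (0 : ℝ), Real.cosh t ^ n * Real.exp (-x * Real.cosh t)

/-- The Euler derivative `x K₀'(x)` of `K₀`. -/
noncomputable def eulerDerivBesselK0 (x : ℝ) : ℝ := -x * coshExpIntegral 1 x

/-- The mixed moment `∫₀^∞ x^k K₀(x)^i (x K₀'(x))^j dx`. -/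
noncomputable def mixedBesselMoment (i j k : ℕ) : ℝ :=
  ∫ x in Set.Ioi (0 : ℝ), x ^ k * (besselK0 x ^ i * eulerDerivBesselK0 x ^ j)

lemma coshExpIntegral_zero : coshExpIntegral 0 = besselK0 := by
  ext x
  simp [coshExpIntegral, besselK0]

lemma integrableOn_cosh_pow_mul_exp (n : ℕ) {x : ℝ} (hx : 0 < x) :
    IntegrableOn (fun t => Real.cosh t ^ n * Real.exp (-x * Real.cosh t)) (Set.Ioi 0) := by
  have hint : IntegrableOn
      (fun t => ((n + 1).factorial / x ^ (n + 1) * 2) * Real.exp (-t)) (Set.Ioi 0) :=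
    (integrableOn_exp_neg_Ioi 0).const_mul _
  refine hint.mono' (by fun_prop) (Filter.Eventually.of_forall fun t => ?_)
  have hc : 0 < Real.cosh t := Real.cosh_pos t
  rw [Real.norm_of_nonneg (by positivity)]
  have h := Real.pow_div_factorial_le_exp (x * Real.cosh t) (by positivity) (n + 1)
  have hcosh : Real.exp t ≤ 2 * Real.cosh t := by
    rw [Real.cosh_eq]
    linarith [Real.exp_pos (-t)]
  rw [neg_mul, Real.exp_neg, Real.exp_neg]
  rw [div_le_iff₀ (by positivity), mul_pow] at h
  rw [← div_eq_mul_inv, ← div_eq_mul_inv, div_le_div_iff₀ (by positivity) (by positivity),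
    div_mul_eq_mul_div, div_mul_eq_mul_div, le_div_iff₀ (by positivity)]
  calc Real.cosh t ^ n * Real.exp t * x ^ (n + 1)
      ≤ Real.cosh t ^ n * (2 * Real.cosh t) * x ^ (n + 1) := by gcongr
    _ = 2 * (x ^ (n + 1) * Real.cosh t ^ (n + 1)) := by ring
    _ ≤ 2 * (Real.exp (x * Real.cosh t) * (n + 1).factorial) := by gcongr
    _ = _ := by ring

lemma hasDerivAt_coshExpIntegral (n : ℕ) {x : ℝ} (hx : 0 < x) :
    HasDerivAt (coshExpIntegral n) (-coshExpIntegral (n + 1) x) x := by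
  have h := (hasDerivAt_integral_of_dominated_loc_of_deriv_le
    (μ := volume.restrict (Set.Ioi (0 : ℝ))) (s := Set.Ioi (x / 2)) (x₀ := x)
    (F := fun y t => Real.cosh t ^ n * Real.exp (-y * Real.cosh t))
    (F' := fun y t => -(Real.cosh t ^ (n + 1) * Real.exp (-y * Real.cosh t)))
    (bound := fun t => Real.cosh t ^ (n + 1) * Real.exp (-(x / 2) * Real.cosh t))
    (Ioi_mem_nhds (by linarith)) (Filter.Eventually.of_forall fun y => by fun_prop)
    (integrableOn_cosh_pow_mul_exp n hx) (by fun_prop)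
    (Filter.Eventually.of_forall fun t y hy => ?_)
    (integrableOn_cosh_pow_mul_exp (n + 1) (by linarith))
    (Filter.Eventually.of_forall fun t y _ => ?_)).2
  · rw [integral_neg] at h
    exact h
  · have hc : 0 < Real.cosh t := Real.cosh_pos t
    have hy' : x / 2 < y := hy
    rw [norm_neg, Real.norm_of_nonneg (by positivity)]
    gcongr
  · have h := ((((hasDerivAt_id y).neg.mul_const (Real.cosh t)).exp).const_mul (Real.cosh t ^ n))
    refine h.congr_deriv ?_
    simp only [id_eq, Pi.neg_apply]
    ring

lemma coshExpIntegral_two {x : ℝ} (hx : 0 < x) :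
    x * coshExpIntegral 2 x = coshExpIntegral 1 x + x * coshExpIntegral 0 x := by
  have h0 := integrableOn_cosh_pow_mul_exp 0 hx
  have h1 := integrableOn_cosh_pow_mul_exp 1 hx
  have h2 := integrableOn_cosh_pow_mul_exp 2 hx
  have hderiv (t : ℝ) : HasDerivAt (fun t => Real.sinh t * Real.exp (-x * Real.cosh t))
      (Real.cosh t ^ 1 * Real.exp (-x * Real.cosh t)
        + x * (Real.cosh t ^ 0 * Real.exp (-x * Real.cosh t))
        - x * (Real.cosh t ^ 2 * Real.exp (-x * Real.cosh t))) t := by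
    refine ((Real.hasDerivAt_sinh t).mul
      ((Real.hasDerivAt_cosh t).const_mul (-x)).exp).congr_deriv ?_
    rw [Real.cosh_sq]
    ring
  have hint := (h1.fun_add (h0.const_mul x)).sub (h2.const_mul x)
  have hsinh : IntegrableOn (fun t => Real.sinh t * Real.exp (-x * Real.cosh t)) (Set.Ioi 0) := by
    refine h1.mono' (by fun_prop) (Filter.Eventually.of_forall fun t => ?_)
    rw [norm_mul, Real.norm_of_nonneg (Real.exp_pos _).le, pow_one, Real.norm_eq_abs]
    gcongr
    rw [abs_le, Real.sinh_eq, Real.cosh_eq]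
    constructor <;> linarith [Real.exp_pos t, Real.exp_pos (-t)]
  have h := integral_Ioi_of_hasDerivAt_of_tendsto (hderiv 0).continuousAt.continuousWithinAt
    (fun t _ => hderiv t) hint
    (tendsto_zero_of_hasDerivAt_of_integrableOn_Ioi (fun t _ => hderiv t) hint hsinh)
  rw [integral_sub (h1.fun_add (h0.const_mul x)) (h2.const_mul x),
    integral_add h1 (h0.const_mul x), integral_const_mul, integral_const_mul] at h
  simp only [Real.sinh_zero, zero_mul, sub_zero] at h
  unfold coshExpIntegral
  linarith

lemma hasDerivAt_besselK0 {x : ℝ} (hx : 0 < x) :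
    HasDerivAt besselK0 (eulerDerivBesselK0 x / x) x := by
  rw [← coshExpIntegral_zero]
  convert hasDerivAt_coshExpIntegral 0 hx using 1
  unfold eulerDerivBesselK0
  field_simp

lemma hasDerivAt_eulerDerivBesselK0 {x : ℝ} (hx : 0 < x) :
    HasDerivAt eulerDerivBesselK0 (x * besselK0 x) x := by
  have h := (hasDerivAt_id x).neg.mul (hasDerivAt_coshExpIntegral 1 hx)
  refine h.congr_deriv ?_
  have h2 := coshExpIntegral_two hx
  simp only [id_eq, Pi.neg_apply, ← coshExpIntegral_zero]
  linarith

lemma besselK0_nonneg (x : ℝ) : 0 ≤ besselK0 x :=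
  integral_nonneg fun _ => (Real.exp_pos _).le

lemma besselK0_le : ∃ C : ℝ, 0 ≤ C ∧ ∀ x, 0 < x →
    besselK0 x ≤ C * (x ^ (-1 / 8 : ℝ) * Real.exp (-(x / 2))) := by
  refine ⟨∫ t in Set.Ioi (0 : ℝ), Real.exp (Real.log 4 / 8) * Real.exp (-(1 / 8) * t),
    integral_nonneg fun _ => by positivity, fun x hx => ?_⟩
  rw [← integral_mul_const]
  refine setIntegral_mono (by simpa using integrableOn_cosh_pow_mul_exp 0 hx)
    (((exp_neg_integrableOn_Ioi 0 (by norm_num)).const_mul _).mul_const _) fun t => ?_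
  have hcosh : 1 / 2 + Real.exp t / 4 ≤ Real.cosh t := by
    have := Real.one_le_cosh t
    rw [Real.cosh_eq] at this ⊢
    linarith [Real.exp_pos (-t)]
  have hlog : Real.log (x * Real.exp t / 4) ≤ x * Real.exp t / 4 :=
    Real.log_le_self (by positivity)
  have hpos : 0 < x * Real.exp t / 4 := by positivity
  rw [Real.log_div (by positivity) (by norm_num), Real.log_mul hx.ne' (by positivity),
    Real.log_exp] at hlog
  have hmul := mul_le_mul_of_nonneg_left hcosh hx.le
  rw [Real.rpow_def_of_pos hx, ← Real.exp_add, ← Real.exp_add, ← Real.exp_add]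
  apply Real.exp_le_exp.mpr
  linarith

lemma abs_eulerDerivBesselK0_le {x : ℝ} (hx : 0 < x) :
    |eulerDerivBesselK0 x| ≤ 2 * besselK0 (x / 2) := by
  have h : 0 ≤ coshExpIntegral 1 x :=
    integral_nonneg fun t => by have := Real.cosh_pos t; positivity
  rw [eulerDerivBesselK0, neg_mul, abs_neg, abs_of_nonneg (by positivity), coshExpIntegral,
    besselK0, ← integral_const_mul, ← integral_const_mul]
  have hint : IntegrableOn (fun t => Real.exp (-(x / 2) * Real.cosh t)) (Set.Ioi 0) := by
    simpa using integrableOn_cosh_pow_mul_exp 0 (half_pos hx)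
  refine setIntegral_mono ((integrableOn_cosh_pow_mul_exp 1 hx).const_mul _)
    (hint.const_mul _) fun t => ?_
  have hle := Real.add_one_le_exp (x * Real.cosh t / 2)
  have hexp : Real.exp (-(x / 2) * Real.cosh t)
      = Real.exp (x * Real.cosh t / 2) * Real.exp (-x * Real.cosh t) := by
    rw [← Real.exp_add]
    ring_nf
  calc x * (Real.cosh t ^ 1 * Real.exp (-x * Real.cosh t))
      = (x * Real.cosh t) * Real.exp (-x * Real.cosh t) := by ring
    _ ≤ (2 * Real.exp (x * Real.cosh t / 2)) * Real.exp (-x * Real.cosh t) := by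
        refine mul_le_mul_of_nonneg_right ?_ (Real.exp_pos _).le
        linarith
    _ = 2 * Real.exp (-(x / 2) * Real.cosh t) := by rw [hexp]; ring

lemma besselK0_eulerDeriv_bound : ∃ C : ℝ, 0 ≤ C ∧ ∀ x, 0 < x →
    |besselK0 x| ≤ C * (x ^ (-1 / 8 : ℝ) * Real.exp (-(x / 4))) ∧
    |eulerDerivBesselK0 x| ≤ C * (x ^ (-1 / 8 : ℝ) * Real.exp (-(x / 4))) := by
  obtain ⟨C, hC, h⟩ := besselK0_le
  refine ⟨C * (1 + 2 * (1 / 2 : ℝ) ^ (-1 / 8 : ℝ)), by positivity, fun x hx => ⟨?_, ?_⟩⟩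
  · rw [abs_of_nonneg (besselK0_nonneg x)]
    refine (h x hx).trans ?_
    gcongr ?_ * (_ * Real.exp ?_)
    · exact le_mul_of_one_le_right hC (le_add_of_nonneg_right (by positivity))
    · linarith
  · have hhalf : (x / 2) ^ (-1 / 8 : ℝ) = (1 / 2 : ℝ) ^ (-1 / 8 : ℝ) * x ^ (-1 / 8 : ℝ) := by
      rw [← Real.mul_rpow (by norm_num) hx.le]
      ring_nf
    have hE : 0 ≤ C * (x ^ (-1 / 8 : ℝ) * Real.exp (-(x / 4))) := by positivity
    calc |eulerDerivBesselK0 x| ≤ 2 * besselK0 (x / 2) := abs_eulerDerivBesselK0_le hx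
      _ ≤ 2 * (C * ((x / 2) ^ (-1 / 8 : ℝ) * Real.exp (-(x / 2 / 2)))) := by
          gcongr
          exact h _ (half_pos hx)
      _ = (2 * (1 / 2 : ℝ) ^ (-1 / 8 : ℝ)) * (C * (x ^ (-1 / 8 : ℝ) * Real.exp (-(x / 4)))) := by
          rw [hhalf, show x / 2 / 2 = x / 4 by ring]
          ring
      _ ≤ (1 + 2 * (1 / 2 : ℝ) ^ (-1 / 8 : ℝ))
          * (C * (x ^ (-1 / 8 : ℝ) * Real.exp (-(x / 4)))) := by
          gcongr
          linarith
      _ = _ := by ring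

lemma mixedBessel_bound (i j k : ℕ) : ∃ C : ℝ, ∀ x, 0 < x →
    ‖x ^ k * (besselK0 x ^ i * eulerDerivBesselK0 x ^ j)‖
      ≤ C * (x ^ (k - (i + j) / 8 : ℝ) * Real.exp (-((i + j) / 4) * x ^ (1 : ℝ))) := by
  obtain ⟨C, hC, h⟩ := besselK0_eulerDeriv_bound
  refine ⟨C ^ (i + j), fun x hx => ?_⟩
  obtain ⟨hK, hL⟩ := h x hx
  rw [norm_mul, norm_mul, norm_pow, norm_pow, norm_pow, Real.norm_of_nonneg hx.le,
    Real.norm_eq_abs, Real.norm_eq_abs]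
  calc x ^ k * (|besselK0 x| ^ i * |eulerDerivBesselK0 x| ^ j)
      ≤ x ^ k * ((C * (x ^ (-1 / 8 : ℝ) * Real.exp (-(x / 4)))) ^ i
          * (C * (x ^ (-1 / 8 : ℝ) * Real.exp (-(x / 4)))) ^ j) := by gcongr
    _ = C ^ (i + j) * ((x ^ k * (x ^ (-1 / 8 : ℝ)) ^ (i + j))
          * Real.exp (-(x / 4)) ^ (i + j)) := by
        rw [← pow_add]
        ring
    _ = _ := by
        rw [← Real.exp_nat_mul, ← Real.rpow_natCast (x ^ (-1 / 8 : ℝ)), ← Real.rpow_mul hx.le,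
          ← Real.rpow_natCast x k, ← Real.rpow_add hx, Real.rpow_one]
        push_cast
        ring_nf

lemma hasDerivAt_mixedBessel (i j k : ℕ) {x : ℝ} (hx : 0 < x) :
    HasDerivAt (fun x => x ^ (k + 1) * (besselK0 x ^ i * eulerDerivBesselK0 x ^ j))
      ((k + 1) * (x ^ k * (besselK0 x ^ i * eulerDerivBesselK0 x ^ j))
        + i * (x ^ k * (besselK0 x ^ (i - 1) * eulerDerivBesselK0 x ^ (j + 1)))
        + j * (x ^ (k + 2) * (besselK0 x ^ (i + 1) * eulerDerivBesselK0 x ^ (j - 1)))) x := by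
  refine ((hasDerivAt_pow (k + 1) x).mul (((hasDerivAt_besselK0 hx).pow i).mul
    ((hasDerivAt_eulerDerivBesselK0 hx).pow j))).congr_deriv ?_
  simp only [Pi.mul_apply, Pi.pow_apply, Nat.add_sub_cancel]
  push_cast
  field_simp
  ring

lemma integrableOn_mixedBessel {i j : ℕ} (k : ℕ) (hpos : 0 < i + j) (hlt : i + j < 8) :
    IntegrableOn (fun x => x ^ k * (besselK0 x ^ i * eulerDerivBesselK0 x ^ j)) (Set.Ioi 0) := by
  obtain ⟨C, hC⟩ := mixedBessel_bound i j k
  have hpos' : (0 : ℝ) < i + j := by exact_mod_cast hpos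
  have hlt' : (i + j : ℝ) < 8 := by exact_mod_cast hlt
  have hk : (0 : ℝ) ≤ k := k.cast_nonneg
  have hint := (integrableOn_rpow_mul_exp_neg_mul_rpow (s := k - (i + j) / 8)
    (b := (i + j : ℝ) / 4) (by linarith) one_pos (by positivity)).const_mul C
  refine Integrable.mono' hint ?_ ((ae_restrict_iff' measurableSet_Ioi).mpr
    (Filter.Eventually.of_forall hC))
  refine ContinuousOn.aestronglyMeasurable (fun x hx => ?_) measurableSet_Ioi
  have hK := (hasDerivAt_besselK0 hx).continuousAt
  have hL := (hasDerivAt_eulerDerivBesselK0 hx).continuousAt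
  exact ContinuousAt.continuousWithinAt (by fun_prop)

lemma continuousWithinAt_mixedBessel {i j : ℕ} (k : ℕ) (hlt : i + j < 8) :
    ContinuousWithinAt (fun x => x ^ (k + 1) * (besselK0 x ^ i * eulerDerivBesselK0 x ^ j))
      (Set.Ici 0) 0 := by
  obtain ⟨C, hC⟩ := mixedBessel_bound i j (k + 1)
  have hlt' : (i + j : ℝ) < 8 := by exact_mod_cast hlt
  have hk : (0 : ℝ) ≤ k := k.cast_nonneg
  have hexp : 0 < ((k + 1 : ℕ) - (i + j) / 8 : ℝ) := by
    push_cast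
    linarith
  rw [← continuousWithinAt_Ioi_iff_Ici, ContinuousWithinAt, zero_pow k.succ_ne_zero, zero_mul]
  refine squeeze_zero_norm' (Filter.eventually_of_mem self_mem_nhdsWithin hC) ?_
  have hcont : ContinuousAt (fun x : ℝ => C * (x ^ ((k + 1 : ℕ) - (i + j) / 8 : ℝ)
      * Real.exp (-((i + j) / 4) * x ^ (1 : ℝ)))) 0 := by
    have h1 := Real.continuousAt_rpow_const 0 _ (Or.inr hexp.le)
    have h2 := Real.continuousAt_rpow_const 0 1 (Or.inr zero_le_one)
    fun_prop
  have h := hcont.tendsto.mono_left (nhdsWithin_le_nhds (s := Set.Ioi 0))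
  rwa [Real.zero_rpow hexp.ne', zero_mul, mul_zero] at h

lemma mixedBesselMoment_integration_by_parts {i j : ℕ} (k : ℕ) (hpos : 1 < i + j)
    (hlt : i + j < 7) :
    (k + 1) * mixedBesselMoment i j k + i * mixedBesselMoment (i - 1) (j + 1) k
      + j * mixedBesselMoment (i + 1) (j - 1) (k + 2) = 0 := by
  have h1 := (integrableOn_mixedBessel (i := i) (j := j) k (by omega) (by omega)).const_mul
    (k + 1 : ℝ)
  have h2 := (integrableOn_mixedBessel (i := i - 1) (j := j + 1) k (by omega)
    (by omega)).const_mul (i : ℝ)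
  have h3 := (integrableOn_mixedBessel (i := i + 1) (j := j - 1) (k + 2) (by omega)
    (by omega)).const_mul (j : ℝ)
  have hint := (h1.fun_add h2).add h3
  have h := integral_Ioi_of_hasDerivAt_of_tendsto
    (continuousWithinAt_mixedBessel (i := i) (j := j) k (by omega))
    (fun x hx => hasDerivAt_mixedBessel i j k hx) hint
    (tendsto_zero_of_hasDerivAt_of_integrableOn_Ioi
      (fun x hx => hasDerivAt_mixedBessel i j k hx) hint
      (integrableOn_mixedBessel (k + 1) (by omega) (by omega)))
  rw [integral_add (h1.fun_add h2) h3, integral_add h1 h2, integral_const_mul, integral_const_mul,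
    integral_const_mul, zero_pow k.succ_ne_zero, zero_mul, sub_zero] at h
  exact h

lemma besselMoment_eq_mixedBesselMoment (m k : ℕ) :
    besselMoment m k = mixedBesselMoment m 0 k := by
  simp [besselMoment, mixedBesselMoment]

/-- For every integer `k ≥ 0`,
`64(k+3) c_{4,k+4} − 4(k+2)(5k²+20k+23) c_{4,k+2} + (k+1)⁵ c_{4,k} = 0`. -/
theorem bessel_moment_four_recursion (k : ℕ) :
    64 * ((k : ℝ) + 3) * besselMoment 4 (k + 4)
      - 4 * ((k : ℝ) + 2) * (5 * (k : ℝ) ^ 2 + 20 * k + 23) * besselMoment 4 (k + 2)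
      + ((k : ℝ) + 1) ^ 5 * besselMoment 4 k = 0 := by
  simp only [besselMoment_eq_mixedBesselMoment]
  have e0 := mixedBesselMoment_integration_by_parts (i := 4) (j := 0) k (by norm_num) (by norm_num)
  have e1 := mixedBesselMoment_integration_by_parts (i := 3) (j := 1) k (by norm_num) (by norm_num)
  have e2 := mixedBesselMoment_integration_by_parts (i := 2) (j := 2) k (by norm_num) (by norm_num)
  have e3 := mixedBesselMoment_integration_by_parts (i := 1) (j := 3) k (by norm_num) (by norm_num)
  have e4 := mixedBesselMoment_integration_by_parts (i := 0) (j := 4) k (by norm_num) (by norm_num)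
  have f0 := mixedBesselMoment_integration_by_parts (i := 4) (j := 0) (k + 2)
    (by norm_num) (by norm_num)
  have f1 := mixedBesselMoment_integration_by_parts (i := 3) (j := 1) (k + 2)
    (by norm_num) (by norm_num)
  have f2 := mixedBesselMoment_integration_by_parts (i := 2) (j := 2) (k + 2)
    (by norm_num) (by norm_num)
  have g0 := mixedBesselMoment_integration_by_parts (i := 4) (j := 0) (k + 4)
    (by norm_num) (by norm_num)
  norm_num [add_assoc] at e0 e1 e2 e3 e4 f0 f1 f2 g0
  linear_combination ((k : ℝ) + 1) ^ 4 * e0 - 4 * ((k : ℝ) + 1) ^ 3 * e1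
    + 12 * ((k : ℝ) + 1) ^ 2 * e2 - 24 * ((k : ℝ) + 1) * e3 + 24 * e4
    - (16 * ((k : ℝ) + 1) ^ 2 + 28 * ((k : ℝ) + 1) + 16) * f0
    + (40 * ((k : ℝ) + 1) + 32) * f1 - 48 * f2 + 24 * g0
end

section
/- Let A_n = Σ_{k=0}^n C(n,k)²·C(2k,k)·C(2n−2k,n−k) and let (B_n) be determined by B_0 = 0, B_1 = 1 and the recursion (n+2)³B_{n+2} = 2(2n+3)(5n²+15n+12)B_{n+1} − 64(n+1)³B_n. Then the sequence B_n/A_n converges, and its limit is (7/24)·ζ(3). -/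
/-- `ζ(3) = Σ_{n≥1} 1/n³`. -/
noncomputable def zeta3 : ℝ := ∑' n : ℕ, 1 / ((n : ℝ) + 1) ^ 3

open Filter Topology

/-- The hypergeometric term `4ⁿ n!² (m+1)ₙ / ((m+1/2)ₙ₊₁)³`, defined by its ratio in `n`. -/
noncomputable def remainderTerm : ℕ → ℕ → ℝ
  | 0, m => 1 / ((m : ℝ) + 1 / 2) ^ 3
  | n + 1, m => remainderTerm n m *
      (4 * ((n : ℝ) + 1) ^ 2 * (n + m + 1) / ((n : ℝ) + m + 3 / 2) ^ 3)

/-- The remainder `∑ₘ remainderTerm n m`, which equals `7 ζ(3) Aₙ - 24 Bₙ`. -/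
noncomputable def remainder (n : ℕ) : ℝ := ∑' m, remainderTerm n m

/-- The summand of the Domb number with index `k + m`. -/
noncomputable def dombTerm (k m : ℕ) : ℝ :=
  ((k + m).choose k : ℝ) ^ 2 * (k.centralBinom : ℝ) * (m.centralBinom : ℝ)

/-- The Domb numbers. -/
noncomputable def domb (n : ℕ) : ℝ := ∑ k ∈ Finset.range (n + 1), dombTerm k (n - k)

/-- The recursion of the Domb numbers. -/
def IsDombRec (u : ℕ → ℝ) : Prop :=
  ∀ n : ℕ, ((n : ℝ) + 2) ^ 3 * u (n + 2)
    = 2 * (2 * (n : ℝ) + 3) * (5 * (n : ℝ) ^ 2 + 15 * n + 12) * u (n + 1)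
      - 64 * ((n : ℝ) + 1) ^ 3 * u n

lemma IsDombRec.eq_of_init {u v : ℕ → ℝ} (hu : IsDombRec u) (hv : IsDombRec v)
    (h0 : u 0 = v 0) (h1 : u 1 = v 1) (n : ℕ) : u n = v n := by
  induction n using Nat.strong_induction_on with
  | _ n ih =>
    match n with
    | 0 => exact h0
    | 1 => exact h1
    | n + 2 =>
      have hpos : ((n : ℝ) + 2) ^ 3 ≠ 0 := by positivity
      apply mul_left_cancel₀ hpos
      rw [hu n, hv n, ih n (by omega), ih (n + 1) (by omega)]

lemma remainderTerm_nonneg (n m : ℕ) : 0 ≤ remainderTerm n m := by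
  induction n with
  | zero => rw [remainderTerm]; positivity
  | succ n ih => rw [remainderTerm]; positivity

lemma remainderTerm_le (n m : ℕ) :
    remainderTerm n m ≤ 4 ^ n * (1 / ((m : ℝ) + 1 / 2) ^ 3) := by
  induction n with
  | zero => simp [remainderTerm]
  | succ n ih =>
    rw [remainderTerm]
    have hn : (0 : ℝ) ≤ n := n.cast_nonneg
    have hm : (0 : ℝ) ≤ m := m.cast_nonneg
    have h : 4 * ((n : ℝ) + 1) ^ 2 * (n + m + 1) / ((n : ℝ) + m + 3 / 2) ^ 3 ≤ 4 := by
      rw [div_le_iff₀ (by positivity)]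
      have h1 : ((n : ℝ) + 1) ^ 2 * (n + m + 1) ≤
          ((n : ℝ) + m + 3 / 2) ^ 2 * (n + m + 3 / 2) := by
        gcongr <;> linarith
      linarith
    calc _ ≤ 4 ^ n * (1 / ((m : ℝ) + 1 / 2) ^ 3) * 4 := by
          apply mul_le_mul ih h (by positivity) (by positivity)
      _ = _ := by ring

lemma remainderTerm_succ_right (n m : ℕ) :
    remainderTerm n (m + 1) * ((m + 1) * ((m : ℝ) + n + 3 / 2) ^ 3) =
      remainderTerm n m * ((m + n + 1) * ((m : ℝ) + 1 / 2) ^ 3) := by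
  induction n with
  | zero =>
    simp only [remainderTerm]
    push_cast
    have h1 : (m : ℝ) + 1 / 2 ≠ 0 := by positivity
    have h2 : (m : ℝ) + 1 + 1 / 2 ≠ 0 := by positivity
    field_simp
    ring
  | succ n ih =>
    simp only [remainderTerm]
    push_cast
    rw [mul_div_assoc', mul_div_assoc', div_mul_eq_mul_div, div_mul_eq_mul_div,
      div_eq_div_iff (by positivity) (by positivity)]
    linear_combination (4 * ((n : ℝ) + 1) ^ 2 * (n + m + 2) * (m + n + 5 / 2) ^ 3) * ih

/-- Zeilberger certificate for `remainderTerm`. -/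
noncomputable def remainderCert (n m : ℕ) : ℝ :=
  m * (-(208 + 928 * n + 1624 * n ^ 2 + 1392 * n ^ 3 + 584 * n ^ 4 + 96 * n ^ 5 : ℝ)
    - (376 + 1320 * n + 1720 * n ^ 2 + 984 * n ^ 3 + 208 * n ^ 4 : ℝ) * m
    - (192 + 528 * n + 480 * n ^ 2 + 144 * n ^ 3 : ℝ) * m ^ 2
    - (32 + 64 * n + 32 * n ^ 2 : ℝ) * m ^ 3) / ((m : ℝ) + n + 3 / 2) ^ 3 * remainderTerm n m

lemma remainderTerm_telescope (n m : ℕ) :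
    ((n : ℝ) + 2) ^ 3 * remainderTerm (n + 2) m
      - 2 * (2 * (n : ℝ) + 3) * (5 * (n : ℝ) ^ 2 + 15 * n + 12) * remainderTerm (n + 1) m
      + 64 * ((n : ℝ) + 1) ^ 3 * remainderTerm n m
      = remainderCert n (m + 1) - remainderCert n m := by
  have hm : ((m : ℝ) + 1) ≠ 0 := by positivity
  have h1 : (m : ℝ) + n + 3 / 2 ≠ 0 := by positivity
  have h2 : (m : ℝ) + n + 5 / 2 ≠ 0 := by positivity
  have hs : remainderTerm n (m + 1) = remainderTerm n m * ((m + n + 1) * ((m : ℝ) + 1 / 2) ^ 3)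
      / ((m + 1) * ((m : ℝ) + n + 3 / 2) ^ 3) := by
    rw [eq_div_iff (by positivity), remainderTerm_succ_right]
  simp only [remainderCert, remainderTerm, hs]
  push_cast
  rw [show (n : ℝ) + 1 + m + 3 / 2 = m + n + 5 / 2 by ring,
    show (n : ℝ) + m + 3 / 2 = m + n + 3 / 2 by ring,
    show (m : ℝ) + 1 + n + 3 / 2 = m + n + 5 / 2 by ring]
  generalize remainderTerm n m = v
  field_simp
  ring

lemma summable_one_div_add_half_cube :
    Summable fun m : ℕ => 1 / ((m : ℝ) + 1 / 2) ^ 3 := by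
  have h := (Real.summable_one_div_nat_add_rpow (1 / 2) 3).2 (by norm_num)
  refine h.congr fun m => ?_
  have : (0 : ℝ) ≤ m + 1 / 2 := by positivity
  rw [abs_of_nonneg this]
  norm_cast

lemma summable_remainderTerm (n : ℕ) : Summable (remainderTerm n) :=
  Summable.of_nonneg_of_le (remainderTerm_nonneg n) (remainderTerm_le n)
    (summable_one_div_add_half_cube.mul_left _)

lemma tendsto_one_div_add_half_pow {p : ℕ} (hp : p ≠ 0) :
    Tendsto (fun m : ℕ => 1 / ((m : ℝ) + 1 / 2) ^ p) atTop (𝓝 0) := by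
  have h : Tendsto (fun m : ℕ => ((m : ℝ) + 1 / 2) ^ p) atTop atTop :=
    (tendsto_pow_atTop hp).comp (tendsto_atTop_add_const_right _ _ tendsto_natCast_atTop_atTop)
  simp only [one_div] at h ⊢
  exact h.inv_tendsto_atTop

lemma tendsto_remainderCert (n : ℕ) : Tendsto (remainderCert n) atTop (𝓝 0) := by
  set a : ℝ := 208 + 928 * n + 1624 * n ^ 2 + 1392 * n ^ 3 + 584 * n ^ 4 + 96 * n ^ 5 with ha
  set b : ℝ := 376 + 1320 * n + 1720 * n ^ 2 + 984 * n ^ 3 + 208 * n ^ 4 with hb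
  set c : ℝ := 192 + 528 * n + 480 * n ^ 2 + 144 * n ^ 3 with hc
  set d : ℝ := 32 + 64 * n + 32 * n ^ 2 with hd
  have ha0 : 0 ≤ a := by positivity
  have hb0 : 0 ≤ b := by positivity
  have hc0 : 0 ≤ c := by positivity
  have hd0 : 0 ≤ d := by positivity
  have key := ((tendsto_one_div_add_half_pow two_ne_zero).const_mul (4 ^ n * (a + b + c + d)))
  rw [mul_zero] at key
  refine squeeze_zero_norm (fun m => ?_) key
  rcases Nat.eq_zero_or_pos m with rfl | hm
  · simp [remainderCert]
    positivity
  have hm1 : (1 : ℝ) ≤ m := by exact_mod_cast hm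
  have hn : (0 : ℝ) ≤ n := n.cast_nonneg
  have hpoly : m * (a + b * m + c * m ^ 2 + d * m ^ 3) / ((m : ℝ) + n + 3 / 2) ^ 3
      ≤ (a + b + c + d) * (m + 1 / 2) := by
    rw [div_le_iff₀ (by positivity)]
    have e1 : (m : ℝ) ≤ m ^ 3 := le_self_pow₀ hm1 (by norm_num)
    have e2 : (m : ℝ) ^ 2 ≤ m ^ 3 := pow_le_pow_right₀ hm1 (by norm_num)
    have e3 : (1 : ℝ) ≤ m ^ 3 := one_le_pow₀ hm1
    have e4 : a + b * m + c * m ^ 2 + d * m ^ 3 ≤ (a + b + c + d) * m ^ 3 := by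
      nlinarith [mul_le_mul_of_nonneg_left e1 hb0, mul_le_mul_of_nonneg_left e2 hc0,
        mul_le_mul_of_nonneg_left e3 ha0]
    calc m * (a + b * m + c * m ^ 2 + d * m ^ 3) ≤ m * ((a + b + c + d) * m ^ 3) := by gcongr
      _ = (a + b + c + d) * m * m ^ 3 := by ring
      _ ≤ (a + b + c + d) * (m + 1 / 2) * ((m : ℝ) + n + 3 / 2) ^ 3 := by
        gcongr <;> linarith
  have hcert : remainderCert n m = -(m * (a + b * m + c * m ^ 2 + d * m ^ 3)
      / ((m : ℝ) + n + 3 / 2) ^ 3 * remainderTerm n m) := by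
    rw [remainderCert, ← ha, ← hb, ← hc, ← hd]
    ring
  rw [hcert, norm_neg, Real.norm_of_nonneg
    (mul_nonneg (by positivity) (remainderTerm_nonneg n m))]
  calc _ ≤ (a + b + c + d) * (m + 1 / 2) * (4 ^ n * (1 / ((m : ℝ) + 1 / 2) ^ 3)) :=
        mul_le_mul hpoly (remainderTerm_le n m) (remainderTerm_nonneg n m) (by positivity)
    _ = _ := by field_simp

lemma hasSum_telescope {f F : ℕ → ℝ} {l : ℝ} (hf : Summable f)
    (h : ∀ m, f m = F (m + 1) - F m) (hF : Tendsto F atTop (𝓝 l)) : HasSum f (l - F 0) := by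
  rw [hf.hasSum_iff_tendsto_nat]
  simp_rw [h, Finset.sum_range_sub]
  exact hF.sub_const _

lemma isDombRec_remainder : IsDombRec remainder := by
  intro n
  have h2 := (summable_remainderTerm (n + 2)).hasSum.mul_left (((n : ℝ) + 2) ^ 3)
  have h1 := (summable_remainderTerm (n + 1)).hasSum.mul_left
    (2 * (2 * (n : ℝ) + 3) * (5 * (n : ℝ) ^ 2 + 15 * n + 12))
  have h0 := (summable_remainderTerm n).hasSum.mul_left (64 * ((n : ℝ) + 1) ^ 3)
  have h := (h2.sub h1).add h0
  have h' := hasSum_telescope h.summable (remainderTerm_telescope n) (tendsto_remainderCert n)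
  have e := h.unique h'
  have c0 : remainderCert n 0 = 0 := by simp [remainderCert]
  rw [c0] at e
  simp only [remainder]
  linarith

lemma remainder_zero : remainder 0 = 7 * zeta3 := by
  have hs : Summable fun n : ℕ => 1 / ((n : ℝ) + 1) ^ 3 := by
    have := (summable_nat_add_iff 1).2 (Real.summable_one_div_nat_pow.2 (by norm_num : 1 < 3))
    simpa using this
  have he : Summable fun k : ℕ => 1 / (((2 * k : ℕ) : ℝ) + 1) ^ 3 :=
    hs.comp_injective (i := fun k : ℕ => 2 * k) (fun a b h => by simpa using h)
  have ho : Summable fun k : ℕ => 1 / (((2 * k + 1 : ℕ) : ℝ) + 1) ^ 3 :=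
    hs.comp_injective (i := fun k : ℕ => 2 * k + 1) (fun a b h => by simpa using h)
  have h := tsum_even_add_odd (f := fun n : ℕ => 1 / ((n : ℝ) + 1) ^ 3) he ho
  have e1 : ∑' k : ℕ, 1 / (((2 * k : ℕ) : ℝ) + 1) ^ 3 = 1 / 8 * remainder 0 := by
    rw [remainder, ← tsum_mul_left]
    refine tsum_congr fun k => ?_
    rw [remainderTerm]
    push_cast
    field_simp
    norm_num
  have e2 : ∑' k : ℕ, 1 / (((2 * k + 1 : ℕ) : ℝ) + 1) ^ 3 = 1 / 8 * zeta3 := by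
    rw [zeta3, ← tsum_mul_left]
    refine tsum_congr fun k => ?_
    push_cast
    rw [show 2 * (k : ℝ) + 1 + 1 = 2 * (k + 1) by ring]
    field_simp
    norm_num
  rw [e1, e2, ← zeta3] at h
  linarith

lemma remainder_one : remainder 1 = 4 * remainder 0 - 24 := by
  have h1 := (summable_remainderTerm 1).hasSum
  have h0 := (summable_remainderTerm 0).hasSum.mul_left 4
  have h := h1.sub h0
  have hF := ((tendsto_one_div_add_half_pow three_ne_zero).const_mul 2).add
    ((tendsto_one_div_add_half_pow two_ne_zero).const_mul 2)
  have h' := hasSum_telescope h.summable (fun m => by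
    simp only [remainderTerm]
    push_cast
    have h1 : (m : ℝ) + 1 / 2 ≠ 0 := by positivity
    have h2 : (m : ℝ) + 3 / 2 ≠ 0 := by positivity
    rw [show (0 : ℝ) + m + 3 / 2 = m + 3 / 2 by ring,
      show (m : ℝ) + 1 + 1 / 2 = m + 3 / 2 by ring]
    field_simp
    ring) hF
  have e := h.unique h'
  simp only [remainder]
  norm_num at e
  linarith

lemma remainder_nonneg (n : ℕ) : 0 ≤ remainder n := tsum_nonneg (remainderTerm_nonneg n)

lemma remainder_le (n : ℕ) : remainder n ≤ 4 ^ n * remainder 0 := by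
  rw [remainder, remainder, ← tsum_mul_left]
  exact (summable_remainderTerm n).tsum_le_tsum (remainderTerm_le n)
    ((summable_remainderTerm 0).mul_left _)

lemma dombTerm_comm (k m : ℕ) : dombTerm k m = dombTerm m k := by
  rw [dombTerm, dombTerm, add_comm m k, Nat.choose_symm_add]
  ring

lemma dombTerm_succ_right (k m : ℕ) :
    dombTerm k (m + 1) * ((m : ℝ) + 1) ^ 3 =
      dombTerm k m * (2 * ((k : ℝ) + m + 1) ^ 2 * (2 * m + 1)) := by
  have h1 : ((m : ℝ) + 1) * ((m + 1).centralBinom : ℝ) = 2 * (2 * m + 1) * m.centralBinom := by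
    exact_mod_cast Nat.succ_mul_centralBinom_succ m
  have h2 : ((k + m).choose k : ℝ) * (k + m + 1) = ((k + (m + 1)).choose k : ℝ) * (m + 1) := by
    have := Nat.choose_mul_succ_eq (k + m) k
    rw [show k + m + 1 - k = m + 1 by omega] at this
    exact_mod_cast this
  rw [dombTerm, dombTerm]
  calc _ = (((k + (m + 1)).choose k : ℝ) * (m + 1)) ^ 2 * k.centralBinom *
        (((m : ℝ) + 1) * ((m + 1).centralBinom : ℝ)) := by ring
    _ = _ := by rw [h1, ← h2]; ring

lemma dombTerm_succ_left (k m : ℕ) :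
    dombTerm (k + 1) m * ((k : ℝ) + 1) ^ 3 =
      dombTerm k m * (2 * ((k : ℝ) + m + 1) ^ 2 * (2 * k + 1)) := by
  rw [dombTerm_comm, dombTerm_succ_right, dombTerm_comm m k]
  ring

/-- Zeilberger certificate for `dombTerm`, at index `n = k + m - 1`. -/
noncomputable def dombCert (n : ℝ) (k m : ℕ) : ℝ :=
  k ^ 3 * (-(224 + 864 * n + 1304 * n ^ 2 + 960 * n ^ 3 + 344 * n ^ 4 + 48 * n ^ 5)
    + (296 + 948 * n + 1112 * n ^ 2 + 564 * n ^ 3 + 104 * n ^ 4) * k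
    - (120 + 312 * n + 264 * n ^ 2 + 72 * n ^ 3) * k ^ 2
    + (16 + 32 * n + 16 * n ^ 2) * k ^ 3) / (2 * (n + 1) ^ 2 * ((m : ℝ) + 1) ^ 3) * dombTerm k m

lemma dombTerm_telescope (k m : ℕ) :
    ((k : ℝ) + m + 2) ^ 3 * dombTerm k (m + 2)
      - 2 * (2 * ((k : ℝ) + m) + 3) * (5 * ((k : ℝ) + m) ^ 2 + 15 * (k + m) + 12)
        * dombTerm k (m + 1)
      + 64 * ((k : ℝ) + m + 1) ^ 3 * dombTerm k m
      = dombCert (k + m) (k + 1) m - dombCert (k + m) k (m + 1) := by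
  have hm : (m : ℝ) + 1 ≠ 0 := by positivity
  have hm2 : (m : ℝ) + 2 ≠ 0 := by positivity
  have hk : (k : ℝ) + 1 ≠ 0 := by positivity
  have hn : (k : ℝ) + m + 1 ≠ 0 := by positivity
  have h1 : dombTerm k (m + 1) = dombTerm k m * (2 * ((k : ℝ) + m + 1) ^ 2 * (2 * m + 1))
      / ((m : ℝ) + 1) ^ 3 := by
    rw [eq_div_iff (by positivity), dombTerm_succ_right]
  have h2 : dombTerm k (m + 2) = dombTerm k (m + 1) * (2 * ((k : ℝ) + m + 2) ^ 2 * (2 * m + 3))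
      / ((m : ℝ) + 2) ^ 3 := by
    rw [eq_div_iff (by positivity)]
    have := dombTerm_succ_right k (m + 1)
    push_cast at this
    linear_combination this
  have h3 : dombTerm (k + 1) m = dombTerm k m * (2 * ((k : ℝ) + m + 1) ^ 2 * (2 * k + 1))
      / ((k : ℝ) + 1) ^ 3 := by
    rw [eq_div_iff (by positivity), dombTerm_succ_left]
  simp only [dombCert, h2, h1, h3]
  push_cast
  rw [show (m : ℝ) + 1 + 1 = m + 2 by ring]
  generalize dombTerm k m = v
  field_simp
  ring

lemma isDombRec_domb : IsDombRec domb := by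
  intro n
  have key : ∀ K ≤ n + 1, ∑ k ∈ Finset.range K,
      (((n : ℝ) + 2) ^ 3 * dombTerm k (n + 2 - k)
      - 2 * (2 * (n : ℝ) + 3) * (5 * (n : ℝ) ^ 2 + 15 * n + 12) * dombTerm k (n + 1 - k)
      + 64 * ((n : ℝ) + 1) ^ 3 * dombTerm k (n - k)) = dombCert n K (n + 1 - K) := by
    intro K hK
    induction K with
    | zero => simp [dombCert]
    | succ K ih =>
      obtain ⟨m, rfl⟩ : ∃ m, n = K + m := ⟨n - K, by omega⟩
      rw [Finset.sum_range_succ, ih (by omega), show K + m + 2 - K = m + 2 by omega,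
        show K + m + 1 - K = m + 1 by omega, show K + m - K = m by omega,
        show K + m + 1 - (K + 1) = m by omega]
      have := dombTerm_telescope K m
      push_cast
      linarith
  have h := key (n + 1) le_rfl
  have e2 : domb (n + 2) = ∑ k ∈ Finset.range (n + 1), dombTerm k (n + 2 - k)
      + dombTerm (n + 1) 1 + dombTerm (n + 2) 0 := by
    rw [domb, Finset.sum_range_succ, Finset.sum_range_succ, show n + 2 - (n + 1) = 1 by omega,
      Nat.sub_self]
  have e1 : domb (n + 1) = ∑ k ∈ Finset.range (n + 1), dombTerm k (n + 1 - k)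
      + dombTerm (n + 1) 0 := by
    rw [domb, Finset.sum_range_succ, Nat.sub_self]
  rw [Finset.sum_add_distrib, Finset.sum_sub_distrib, ← Finset.mul_sum, ← Finset.mul_sum,
    ← Finset.mul_sum, Nat.sub_self] at h
  have hn1 : (n : ℝ) + 1 ≠ 0 := by positivity
  have hn2 : (n : ℝ) + 2 ≠ 0 := by positivity
  have f1 := dombTerm_succ_right (n + 1) 0
  have f2 : dombTerm (n + 2) 0 = dombTerm (n + 1) 0 * (2 * (2 * n + 3)) / ((n : ℝ) + 2) := by
    rw [eq_div_iff hn2]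
    have := dombTerm_succ_left (n + 1) 0
    push_cast at this
    apply mul_right_cancel₀ (pow_ne_zero 2 hn2)
    linear_combination this
  have hc : dombCert n (n + 1) 0 = ((n : ℝ) + 1) / 2 *
      (-(224 + 864 * n + 1304 * n ^ 2 + 960 * n ^ 3 + 344 * n ^ 4 + 48 * n ^ 5)
    + (296 + 948 * n + 1112 * n ^ 2 + 564 * n ^ 3 + 104 * n ^ 4) * (n + 1)
    - (120 + 312 * n + 264 * n ^ 2 + 72 * n ^ 3) * (n + 1) ^ 2
    + (16 + 32 * n + 16 * n ^ 2) * (n + 1) ^ 3) * dombTerm (n + 1) 0 := by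
    rw [dombCert]
    push_cast
    field_simp
    ring
  norm_num at f1
  rw [hc] at h
  rw [e2, e1, f2, f1]
  change _ = _ - 64 * ((n : ℝ) + 1) ^ 3 * ∑ k ∈ Finset.range (n + 1), dombTerm k (n - k)
  have hdiv : ((n : ℝ) + 2) ^ 3 * (dombTerm (n + 1) 0 * (2 * (2 * n + 3)) / ((n : ℝ) + 2))
      = ((n : ℝ) + 2) ^ 2 * (dombTerm (n + 1) 0 * (2 * (2 * n + 3))) := by
    field_simp
  linear_combination h + hdiv

lemma domb_lower_bound (n : ℕ) : ((n : ℝ) + 1) / 4 * 4 ^ (n + 1) ≤ domb (n + 1) := by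
  have hle : dombTerm 1 n ≤ domb (n + 1) := by
    have := Finset.single_le_sum (f := fun k => dombTerm k (n + 1 - k))
      (s := Finset.range (n + 1 + 1)) (fun k _ => by rw [dombTerm]; positivity)
      (Finset.mem_range.2 (show 1 < n + 1 + 1 by omega))
    simpa [domb] using this
  refine le_trans ?_ hle
  have h1 : dombTerm 1 n = 2 * ((n : ℝ) + 1) ^ 2 * n.centralBinom := by
    have hc : (Nat.centralBinom 1 : ℝ) = 2 := by norm_num [Nat.centralBinom]
    rw [dombTerm, Nat.choose_one_right, hc]
    push_cast
    ring
  have h2 : (4 : ℝ) ^ n ≤ 2 * (n + 1) * n.centralBinom := by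
    rcases Nat.eq_zero_or_pos n with rfl | hn
    · simp
    have h : (4 : ℝ) ^ n ≤ 2 * n * n.centralBinom := by
      exact_mod_cast Nat.four_pow_le_two_mul_self_mul_centralBinom n hn
    refine h.trans ?_
    gcongr
    linarith
  rw [h1]
  calc ((n : ℝ) + 1) / 4 * 4 ^ (n + 1) = (n + 1) * 4 ^ n := by ring
    _ ≤ (n + 1) * (2 * (n + 1) * n.centralBinom) := by gcongr
    _ = _ := by ring

lemma tendsto_remainder_div_domb :
    Tendsto (fun n => remainder n / domb n) atTop (𝓝 0) := by
  rw [← tendsto_add_atTop_iff_nat 1]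
  have key := (tendsto_one_div_add_atTop_nhds_zero_nat (𝕜 := ℝ)).const_mul (4 * remainder 0)
  rw [mul_zero] at key
  have hpos (n : ℕ) : 0 < domb (n + 1) := lt_of_lt_of_le (by positivity) (domb_lower_bound n)
  refine squeeze_zero (fun n => div_nonneg (remainder_nonneg _) (hpos n).le) (fun n => ?_) key
  rw [div_le_iff₀ (hpos n)]
  calc remainder (n + 1) ≤ 4 ^ (n + 1) * remainder 0 := remainder_le _
    _ = 4 * remainder 0 * (1 / ((n : ℝ) + 1)) * (((n : ℝ) + 1) / 4 * 4 ^ (n + 1)) := by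
      field_simp
    _ ≤ _ := by
      have := remainder_nonneg 0
      gcongr
      exact domb_lower_bound n

/-- With `A_n = Σ_{k=0}^n C(n,k)² C(2k,k) C(2n−2k,n−k)` and `B` the solution of the recursion
`(n+2)³ B_{n+2} = 2(2n+3)(5n²+15n+12) B_{n+1} − 64(n+1)³ B_n` with `B_0 = 0`, `B_1 = 1`,
the sequence `B_n / A_n` converges to `(7/24) ζ(3)`. -/
theorem apery_limit_four
    (A B : ℕ → ℝ)
    (hA : ∀ n, A n = ∑ k ∈ Finset.range (n + 1),
      ((n.choose k : ℝ)) ^ 2 * ((2 * k).choose k : ℝ) * ((2 * n - 2 * k).choose (n - k) : ℝ))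
    (hB0 : B 0 = 0) (hB1 : B 1 = 1)
    (hBrec : ∀ n : ℕ, ((n : ℝ) + 2) ^ 3 * B (n + 2)
      = 2 * (2 * (n : ℝ) + 3) * (5 * (n : ℝ) ^ 2 + 15 * n + 12) * B (n + 1)
        - 64 * ((n : ℝ) + 1) ^ 3 * B n) :
    Filter.Tendsto (fun n => B n / A n) Filter.atTop (nhds (7 / 24 * zeta3)) := by
  have hAd : A = domb := by
    funext n
    rw [hA, domb]
    refine Finset.sum_congr rfl fun k hk => ?_
    have hk' : k ≤ n := by simpa [Nat.lt_succ_iff] using hk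
    rw [dombTerm, Nat.add_sub_cancel' hk', Nat.centralBinom, Nat.centralBinom, Nat.mul_sub]
  subst hAd
  have hrec : IsDombRec fun n => 7 * zeta3 * domb n - 24 * B n := fun n => by
    linear_combination 7 * zeta3 * isDombRec_domb n - 24 * hBrec n
  have h0 : domb 0 = 1 := by simp [domb, dombTerm]
  have h1 : domb 1 = 4 := by
    simp [domb, dombTerm, Finset.sum_range_succ, Nat.centralBinom]
    norm_num
  have hr := isDombRec_remainder.eq_of_init hrec
    (by rw [remainder_zero, h0, hB0]; ring) (by rw [remainder_one, remainder_zero, h1, hB1]; ring)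
  have hlim := (tendsto_remainder_div_domb.const_mul (1 / 24)).const_sub (7 / 24 * zeta3)
  rw [mul_zero, sub_zero] at hlim
  refine hlim.congr' ?_
  filter_upwards [eventually_ge_atTop 1] with n hn
  obtain ⟨m, rfl⟩ : ∃ m, n = m + 1 := ⟨n - 1, by omega⟩
  have hpos : 0 < domb (m + 1) := lt_of_lt_of_le (by positivity) (domb_lower_bound m)
  rw [hr]
  field_simp
  ring
end

section
/- For every integer n ≥ 0, Σ_{k=0}^n C(n,k)²·C(2k,k)·C(2n−2k,n−k) = Σ_{i+j+k+l=n} (n!/(i!·j!·k!·l!))², where the right-hand sum ranges over all quadruples (i,j,k,l) of nonnegative integers with i+j+k+l = n. -/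
open Finset.HasAntidiagonal (antidiagonal mem_antidiagonal)

theorem centralBinom_div_factorial_sq (m : ℕ) :
    ((2 * m).choose m : ℚ) / (m.factorial : ℚ) ^ 2
      = ∑ p ∈ antidiagonal m, (1 / ((p.1.factorial : ℚ) * p.2.factorial)) ^ 2 := by
  have h : ((2 * m).choose m : ℚ) = ∑ p ∈ antidiagonal m, (m.choose p.1 : ℚ) ^ 2 := by
    rw [Finset.Nat.sum_antidiagonal_eq_sum_range_succ_mk]
    exact_mod_cast (Nat.sum_range_choose_sq m).symm
  rw [h, Finset.sum_div]
  refine Finset.sum_congr rfl fun p hp => ?_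
  obtain rfl := mem_antidiagonal.mp hp
  rw [Nat.cast_add_choose]
  field_simp

theorem sum_antidiagonalTuple_four {M : Type*} [AddCommMonoid M] (n : ℕ)
    (g : ℕ → ℕ → ℕ → ℕ → M) :
    ∑ f ∈ Finset.Nat.antidiagonalTuple 4 n, g (f 0) (f 1) (f 2) (f 3)
      = ∑ p ∈ antidiagonal n, ∑ q ∈ antidiagonal p.1,
          ∑ r ∈ antidiagonal p.2, g q.1 q.2 r.1 r.2 := by
  simp only [← Finset.sum_product']
  rw [Finset.sum_sigma']
  refine Finset.sum_bij' (fun f _ => ⟨(f 0 + f 1, f 2 + f 3), ((f 0, f 1), (f 2, f 3))⟩)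
    (fun x _ => ![x.2.1.1, x.2.1.2, x.2.2.1, x.2.2.2]) ?_ ?_ ?_ ?_ ?_
  · intro f hf
    simp only [Finset.Nat.mem_antidiagonalTuple, Fin.sum_univ_four] at hf
    simp [← hf, add_assoc]
  · rintro ⟨⟨a, b⟩, ⟨c, d⟩, ⟨e, f⟩⟩ hx
    simp only [Finset.mem_sigma, Finset.mem_product, mem_antidiagonal] at hx
    simp [Finset.Nat.mem_antidiagonalTuple, Fin.sum_univ_four]
    omega
  · intro f _
    ext i
    fin_cases i <;> rfl
  · rintro ⟨⟨a, b⟩, ⟨c, d⟩, ⟨e, f⟩⟩ hx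
    simp only [Finset.mem_sigma, Finset.mem_product, mem_antidiagonal] at hx
    obtain ⟨-, rfl, rfl⟩ := hx
    rfl
  · intro f _
    rfl

/-- For every `n ≥ 0`,
`Σ_{k=0}^n C(n,k)² C(2k,k) C(2n−2k,n−k) = Σ_{i+j+k+l=n} (n!/(i!j!k!l!))²`. -/
theorem choose_sum_eq_multinomial_square_sum (n : ℕ) :
    ∑ k ∈ Finset.range (n + 1),
        ((n.choose k : ℚ)) ^ 2 * ((2 * k).choose k : ℚ) * ((2 * n - 2 * k).choose (n - k) : ℚ)
      = ∑ f ∈ Finset.Nat.antidiagonalTuple 4 n,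
          ((n.factorial : ℚ) / ((f 0).factorial * (f 1).factorial
            * (f 2).factorial * (f 3).factorial)) ^ 2 := by
  rw [sum_antidiagonalTuple_four n fun a b c d => ((n.factorial : ℚ) / (a.factorial * b.factorial
    * c.factorial * d.factorial)) ^ 2, ← Finset.Nat.sum_antidiagonal_eq_sum_range_succ_mk
    (f := fun p : ℕ × ℕ => (n.choose p.1 : ℚ) ^ 2 * ((2 * p.1).choose p.1 : ℚ)
      * ((2 * n - 2 * p.1).choose (n - p.1) : ℚ))]
  refine Finset.sum_congr rfl fun p hp => ?_
  obtain rfl := mem_antidiagonal.mp hp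
  have h : ∀ q r : ℕ × ℕ, (((p.1 + p.2).factorial : ℚ) / (q.1.factorial * q.2.factorial
      * r.1.factorial * r.2.factorial)) ^ 2 = ((p.1 + p.2).factorial : ℚ) ^ 2 *
      ((1 / ((q.1.factorial : ℚ) * q.2.factorial)) ^ 2 *
        (1 / ((r.1.factorial : ℚ) * r.2.factorial)) ^ 2) := by
    intro q r
    field_simp
  simp only [h, ← Finset.mul_sum, ← Finset.sum_mul, ← centralBinom_div_factorial_sq]
  rw [← Nat.mul_sub, Nat.add_sub_cancel_left, Nat.cast_add_choose]
  field_simp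
end
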